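/- Let 𝒮 be a nonempty compact set of signal matrices with entries in [0,1], and suppose C ≥ 0, λ ≥ 0, R ≥ 0 with Σ_{j∈L_i^out} R_{ij} ≤ 1 for every i ∈ L_entry ∪ L_int. Let n be the number of movements, define c by c_{ij} := Σ_{k∈L_i^in} C_{ki} for i ∈ L_int and c_{ij} := λ_i for i ∈ L_entry, and set V*(x) := min_{S∈𝒮} V(x,S). Then there exists a constant b ≥ 0, independent of x, such that for every nonnegative state x: ε‖x‖₂ ≤ V*(x) ≤ ‖x‖₂² + (√n·ε + 2‖c‖₂)‖x‖₂ + b. -/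

import Mathlib

open Finset

/-- The set of input links of link `i`: those links `k` whose output set contains `i`. -/
def Lin {L : Type*} [Fintype L] [DecidableEq L] (out : L → Finset L) (i : L) : Finset L :=
  Finset.univ.filter (fun k => i ∈ out k)

/-- One-step traffic dynamics `f(x,S,λ;C,R)`, componentwise on movements. -/
noncomputable def fdyn {L : Type*} [Fintype L] [DecidableEq L]
    (Lint : Finset L) (out : L → Finset L)
    (x S C R : L → L → ℝ) (lam : L → ℝ) (i j : L) : ℝ :=
  if i ∈ Lint then
    max (x i j - C i j * S i j) 0 + ∑ k ∈ Lin out i, R i j * min (C k i * S k i) (x k i)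
  else
    max (x i j - C i j * S i j) 0 + R i j * lam i

/-- Augmented dynamics `F(x,S,λ;C,C̃,R)`: the saturation rate appearing with a negative
sign is replaced by `Ct`. -/
noncomputable def Faug {L : Type*} [Fintype L] [DecidableEq L]
    (Lint : Finset L) (out : L → Finset L)
    (x S C Ct R : L → L → ℝ) (lam : L → ℝ) (i j : L) : ℝ :=
  if i ∈ Lint then
    max (x i j - Ct i j * S i j) 0 + ∑ k ∈ Lin out i, R i j * min (C k i * S k i) (x k i)
  else
    max (x i j - Ct i j * S i j) 0 + R i j * lam i

/-- 1-norm of a state over all movements. -/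
noncomputable def norm1 {L : Type*} (Lem : Finset L) (out : L → Finset L)
    (x : L → L → ℝ) : ℝ :=
  ∑ i ∈ Lem, ∑ j ∈ out i, |x i j|

/-- Squared 2-norm of a state over all movements. -/
noncomputable def norm2sq {L : Type*} (Lem : Finset L) (out : L → Finset L)
    (x : L → L → ℝ) : ℝ :=
  ∑ i ∈ Lem, ∑ j ∈ out i, (x i j) ^ 2

/-- 2-norm of a state over all movements. -/
noncomputable def norm2 {L : Type*} (Lem : Finset L) (out : L → Finset L)
    (x : L → L → ℝ) : ℝ :=
  Real.sqrt (norm2sq Lem out x)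

/-- The one-step MPC Lyapunov-type cost `V(x,S)`. -/
noncomputable def Vcost {L : Type*} [Fintype L] [DecidableEq L]
    (Lentry Lint : Finset L) (out : L → Finset L) (eps : ℝ)
    (x S C R : L → L → ℝ) (lam : L → ℝ) : ℝ :=
  eps * norm1 (Lentry ∪ Lint) out x + (∑ i ∈ Lentry, (lam i) ^ 2)
    + ∑ i ∈ Lentry, ∑ j ∈ out i,
        ((x i j) ^ 2 + 2 * R i j * lam i * x i j
          + (C i j) ^ 2 * (S i j) ^ 2 - 2 * C i j * S i j * x i j)
    + ∑ i ∈ Lint, ∑ j ∈ out i, (fdyn Lint out x S C R lam i j) ^ 2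

section MovementNorms

variable {L : Type*} (Lem : Finset L) (out : L → Finset L)

theorem sum_mul_le_norm2_mul_norm2 (x y : L → L → ℝ) :
    ∑ i ∈ Lem, ∑ j ∈ out i, x i j * y i j ≤ norm2 Lem out x * norm2 Lem out y := by
  simp only [norm2, norm2sq, Finset.sum_sigma']
  exact Real.sum_mul_le_sqrt_mul_sqrt _ _ _

theorem norm1_le_sqrt_card_mul_norm2 (x : L → L → ℝ) :
    norm1 Lem out x ≤ √((∑ i ∈ Lem, (out i).card : ℕ) : ℝ) * norm2 Lem out x := by
  have h := sum_mul_le_norm2_mul_norm2 Lem out (fun _ _ => 1) (fun i j => |x i j|)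
  simpa [norm1, norm2, norm2sq] using h

theorem norm2_le_norm1 (x : L → L → ℝ) : norm2 Lem out x ≤ norm1 Lem out x := by
  simp only [norm1, norm2, norm2sq, Finset.sum_sigma']
  refine Real.sqrt_le_iff.2 ⟨Finset.sum_nonneg fun _ _ => abs_nonneg _, ?_⟩
  simpa only [sq_abs] using
    Finset.sum_sq_le_sq_sum_of_nonneg (s := Lem.sigma out) (f := fun p => |x p.1 p.2|)
      fun _ _ => abs_nonneg _

end MovementNorms

theorem entry_cost_le {x S C R l : ℝ} (hx : 0 ≤ x) (hC : 0 ≤ C)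
    (hS : S ∈ Set.Icc (0 : ℝ) 1) (hR : R ≤ 1) (hl : 0 ≤ l) :
    x ^ 2 + 2 * R * l * x + C ^ 2 * S ^ 2 - 2 * C * S * x ≤ x ^ 2 + 2 * (l * x) + C ^ 2 := by
  have hsq : C ^ 2 * S ^ 2 ≤ C ^ 2 :=
    mul_le_of_le_one_right (sq_nonneg _) (pow_le_one₀ hS.1 hS.2)
  have hRl : R * (l * x) ≤ l * x := mul_le_of_le_one_left (mul_nonneg hl hx) hR
  have hCSx := mul_nonneg (mul_nonneg hC hS.1) hx
  linarith

section OneStepCost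

variable {L : Type*} [Fintype L] [DecidableEq L] {Lentry Lint : Finset L} {out : L → Finset L}
  {x S C R : L → L → ℝ} {lam : L → ℝ}

theorem mul_norm2_le_Vcost {eps : ℝ} (heps : 0 ≤ eps)
    (hx : ∀ i ∈ Lentry, ∀ j ∈ out i, 0 ≤ x i j)
    (hlam : ∀ i ∈ Lentry, 0 ≤ lam i)
    (hR : ∀ i ∈ Lentry, ∀ j ∈ out i, 0 ≤ R i j) :
    eps * norm2 (Lentry ∪ Lint) out x ≤ Vcost Lentry Lint out eps x S C R lam := by
  have hnorm := mul_le_mul_of_nonneg_left (norm2_le_norm1 (Lentry ∪ Lint) out x) heps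
  have hlam2 : 0 ≤ ∑ i ∈ Lentry, (lam i) ^ 2 := Finset.sum_nonneg fun _ _ => sq_nonneg _
  have hentry : 0 ≤ ∑ i ∈ Lentry, ∑ j ∈ out i,
      ((x i j) ^ 2 + 2 * R i j * lam i * x i j
        + (C i j) ^ 2 * (S i j) ^ 2 - 2 * C i j * S i j * x i j) := by
    refine Finset.sum_nonneg fun i hi => Finset.sum_nonneg fun j hj => ?_
    have h := mul_nonneg (mul_nonneg (hR i hi j hj) (hlam i hi)) (hx i hi j hj)
    nlinarith [sq_nonneg (x i j - C i j * S i j)]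
  have hint : 0 ≤ ∑ i ∈ Lint, ∑ j ∈ out i, (fdyn Lint out x S C R lam i j) ^ 2 :=
    Finset.sum_nonneg fun _ _ => Finset.sum_nonneg fun _ _ => sq_nonneg _
  unfold Vcost
  linarith

theorem fdyn_sq_le {i j : L} (hi : i ∈ Lint)
    (hx : 0 ≤ x i j) (hxin : ∀ k ∈ Lin out i, 0 ≤ x k i)
    (hC : 0 ≤ C i j) (hCin : ∀ k ∈ Lin out i, 0 ≤ C k i)
    (hS : ∀ k l, S k l ∈ Set.Icc (0 : ℝ) 1)
    (hR0 : 0 ≤ R i j) (hR1 : R i j ≤ 1) :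
    (fdyn Lint out x S C R lam i j) ^ 2 ≤ (x i j + ∑ k ∈ Lin out i, C k i) ^ 2 := by
  have hmin : ∀ k ∈ Lin out i, 0 ≤ min (C k i * S k i) (x k i) := fun k hk =>
    le_min (mul_nonneg (hCin k hk) (hS k i).1) (hxin k hk)
  have hleft : max (x i j - C i j * S i j) 0 ≤ x i j :=
    max_le (sub_le_self _ (mul_nonneg hC (hS i j).1)) hx
  have hright : ∑ k ∈ Lin out i, R i j * min (C k i * S k i) (x k i)
      ≤ ∑ k ∈ Lin out i, C k i := by
    refine Finset.sum_le_sum fun k hk => ?_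
    calc R i j * min (C k i * S k i) (x k i)
        ≤ min (C k i * S k i) (x k i) := mul_le_of_le_one_left (hmin k hk) hR1
      _ ≤ C k i * S k i := min_le_left _ _
      _ ≤ C k i := mul_le_of_le_one_right (hCin k hk) (hS k i).2
  rw [fdyn, if_pos hi]
  exact pow_le_pow_left₀ (add_nonneg (le_max_right _ _)
    (Finset.sum_nonneg fun k hk => mul_nonneg hR0 (hmin k hk))) (add_le_add hleft hright) 2

theorem Vcost_le {eps : ℝ} (heps : 0 ≤ eps)
    (hout : ∀ k i, i ∈ out k → k ∈ Lentry ∪ Lint)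
    (hdisj : Disjoint Lentry Lint)
    (hS : ∀ i j, S i j ∈ Set.Icc (0 : ℝ) 1)
    (hC : ∀ i ∈ Lentry ∪ Lint, ∀ j ∈ out i, 0 ≤ C i j)
    (hlam : ∀ i ∈ Lentry, 0 ≤ lam i)
    (hR : ∀ i ∈ Lentry ∪ Lint, ∀ j ∈ out i, 0 ≤ R i j)
    (hRsum : ∀ i ∈ Lentry ∪ Lint, ∑ j ∈ out i, R i j ≤ 1)
    {c : L → L → ℝ}
    (hc : ∀ i j, c i j = if i ∈ Lint then ∑ k ∈ Lin out i, C k i else lam i)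
    (hx : ∀ i ∈ Lentry ∪ Lint, ∀ j ∈ out i, 0 ≤ x i j) :
    Vcost Lentry Lint out eps x S C R lam ≤
      norm2sq (Lentry ∪ Lint) out x
        + (√((∑ i ∈ Lentry ∪ Lint, (out i).card : ℕ) : ℝ) * eps
            + 2 * norm2 (Lentry ∪ Lint) out c) * norm2 (Lentry ∪ Lint) out x
        + (∑ i ∈ Lentry, (lam i) ^ 2 + norm2sq Lentry out C + norm2sq Lint out c) := by
  have hR1 : ∀ i ∈ Lentry ∪ Lint, ∀ j ∈ out i, R i j ≤ 1 := fun i hi j hj =>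
    (Finset.single_le_sum (f := R i) (fun k hk => hR i hi k hk) hj).trans (hRsum i hi)
  have hnorm := mul_le_mul_of_nonneg_left
    (norm1_le_sqrt_card_mul_norm2 (Lentry ∪ Lint) out x) heps
  have hinner := sum_mul_le_norm2_mul_norm2 (Lentry ∪ Lint) out c x
  have hentry : ∑ i ∈ Lentry, ∑ j ∈ out i,
      ((x i j) ^ 2 + 2 * R i j * lam i * x i j
        + (C i j) ^ 2 * (S i j) ^ 2 - 2 * C i j * S i j * x i j)
      ≤ ∑ i ∈ Lentry, ∑ j ∈ out i, ((x i j) ^ 2 + 2 * (c i j * x i j) + (C i j) ^ 2) := by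
    refine Finset.sum_le_sum fun i hi => Finset.sum_le_sum fun j hj => ?_
    have hi' := Finset.mem_union_left Lint hi
    rw [hc, if_neg (Finset.disjoint_left.1 hdisj hi)]
    exact entry_cost_le (hx i hi' j hj) (hC i hi' j hj) (hS i j) (hR1 i hi' j hj) (hlam i hi)
  have hint : ∑ i ∈ Lint, ∑ j ∈ out i, (fdyn Lint out x S C R lam i j) ^ 2
      ≤ ∑ i ∈ Lint, ∑ j ∈ out i, ((x i j) ^ 2 + 2 * (c i j * x i j) + (c i j) ^ 2) := by
    refine Finset.sum_le_sum fun i hi => Finset.sum_le_sum fun j hj => ?_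
    have hi' := Finset.mem_union_right Lentry hi
    have hmem : ∀ k ∈ Lin out i, i ∈ out k := fun k hk => (Finset.mem_filter.1 hk).2
    rw [hc, if_pos hi]
    refine (fdyn_sq_le hi (hx i hi' j hj) (fun k hk => hx k (hout k i (hmem k hk)) i (hmem k hk))
      (hC i hi' j hj) (fun k hk => hC k (hout k i (hmem k hk)) i (hmem k hk)) hS
      (hR i hi' j hj) (hR1 i hi' j hj)).trans_eq ?_
    ring
  rw [Finset.sum_union hdisj] at hinner
  have hsq : norm2sq (Lentry ∪ Lint) out x = norm2sq Lentry out x + norm2sq Lint out x :=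
    Finset.sum_union hdisj
  simp only [Finset.sum_add_distrib, ← Finset.mul_sum] at hentry hint
  rw [hsq]
  unfold Vcost
  simp only [norm2sq] at hentry hint ⊢
  linarith

end OneStepCost

/-- two-sided bounds `ε‖x‖₂ ≤ V*(x) ≤ ‖x‖₂² + (√n·ε + 2‖c‖₂)‖x‖₂ + b`
on the optimal value function of the one-step MPC. -/
theorem Vstar_sandwich {L : Type*} [Fintype L] [DecidableEq L]
    (Lentry Lint : Finset L) (out : L → Finset L)
    (hout : ∀ k i, i ∈ out k → k ∈ Lentry ∪ Lint)
    (hdisj : Disjoint Lentry Lint)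
    (𝒮 : Set (L → L → ℝ)) (hne : 𝒮.Nonempty) (hcomp : IsCompact 𝒮)
    (hSmem : ∀ S ∈ 𝒮, ∀ i j, S i j ∈ Set.Icc (0 : ℝ) 1)
    (C R : L → L → ℝ) (lam : L → ℝ) (eps : ℝ) (heps : 0 < eps)
    (hC : ∀ i ∈ Lentry ∪ Lint, ∀ j ∈ out i, 0 ≤ C i j)
    (hlam : ∀ i ∈ Lentry, 0 ≤ lam i)
    (hR : ∀ i ∈ Lentry ∪ Lint, ∀ j ∈ out i, 0 ≤ R i j)
    (hRsum : ∀ i ∈ Lentry ∪ Lint, ∑ j ∈ out i, R i j ≤ 1)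
    (c : L → L → ℝ)
    (hc : ∀ i j, c i j = if i ∈ Lint then ∑ k ∈ Lin out i, C k i else lam i)
    (n : ℕ) (hn : n = ∑ i ∈ Lentry ∪ Lint, (out i).card) :
    ∃ b : ℝ, 0 ≤ b ∧
      ∀ x : L → L → ℝ, (∀ i ∈ Lentry ∪ Lint, ∀ j ∈ out i, 0 ≤ x i j) →
        eps * norm2 (Lentry ∪ Lint) out x ≤
          sInf {v : ℝ | ∃ S ∈ 𝒮, v = Vcost Lentry Lint out eps x S C R lam} ∧
        sInf {v : ℝ | ∃ S ∈ 𝒮, v = Vcost Lentry Lint out eps x S C R lam} ≤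
          norm2sq (Lentry ∪ Lint) out x
            + (Real.sqrt (n : ℝ) * eps + 2 * norm2 (Lentry ∪ Lint) out c)
                * norm2 (Lentry ∪ Lint) out x
            + b := by
  refine ⟨∑ i ∈ Lentry, (lam i) ^ 2 + norm2sq Lentry out C + norm2sq Lint out c,
    by unfold norm2sq; positivity, fun x hx => ?_⟩
  have hlower : ∀ v ∈ {v : ℝ | ∃ S ∈ 𝒮, v = Vcost Lentry Lint out eps x S C R lam},
      eps * norm2 (Lentry ∪ Lint) out x ≤ v := by
    rintro v ⟨S, -, rfl⟩
    exact mul_norm2_le_Vcost heps.le (fun i hi => hx i (Finset.mem_union_left _ hi)) hlam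
      fun i hi => hR i (Finset.mem_union_left _ hi)
  obtain ⟨S, hS⟩ := hne
  refine ⟨le_csInf ⟨_, S, hS, rfl⟩ hlower, (csInf_le ⟨_, hlower⟩ ⟨S, hS, rfl⟩).trans ?_⟩
  rw [hn]
  exact Vcost_le heps.le hout hdisj (hSmem S hS) hC hlam hR hRsum hc hx
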